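/- arXiv:1510.07179 — 3 statements merged into one kernel-verified Lean document; each statement's English description precedes it below -/
import Mathlib

section
/- There is no set Y ⊆ R^d and constant C > 0 such that for every convex set K of volume 1, 1 ≤ #(K ∩ Y) ≤ C. -/
open MeasureTheory Set

section GowersSet

open Module Metric

variable {E : Type*} [NormedAddCommGroup E] [InnerProductSpace ℝ E] [FiniteDimensional ℝ E]

/-- A linear map of determinant one contracting a prescribed vector `p` by a factor at least `T`
while expanding any other vector by a factor at most `2 * T`. -/
theorem exists_linearMap_det_eq_one_contracting (hd : 2 ≤ finrank ℝ E) {p : E} (hp : p ≠ 0)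
    {T : ℝ} (hT : 1 ≤ T) :
    ∃ h : E →ₗ[ℝ] E, LinearMap.det h = 1 ∧ ‖h p‖ ≤ T⁻¹ * ‖p‖ ∧ ∀ x, ‖h x‖ ≤ 2 * T * ‖x‖ := by
  have hT0 : 0 < T := by linarith
  have hp0 : 0 < ‖p‖ := norm_pos_iff.mpr hp
  set c : ℝ := (T ^ finrank ℝ E)⁻¹ with hc
  have hc0 : 0 < c := by positivity
  have hcT : T * c ≤ T⁻¹ := by
    have hpow : T ^ 2 ≤ T ^ finrank ℝ E := pow_le_pow_right₀ hT hd
    have : c ≤ (T ^ 2)⁻¹ := inv_anti₀ (by positivity) hpow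
    calc T * c ≤ T * (T ^ 2)⁻¹ := by gcongr
      _ = T⁻¹ := by field_simp
  have hc1 : c ≤ 1 := inv_le_one_of_one_le₀ (one_le_pow₀ hT)
  let f : Dual ℝ E := (‖p‖ ^ 2)⁻¹ • (innerₛₗ ℝ p)
  have hfx (x : E) : f x = (‖p‖ ^ 2)⁻¹ * inner ℝ p x := rfl
  have hfp : f p = 1 := by
    rw [hfx, real_inner_self_eq_norm_sq]
    field_simp
  have hf (x : E) : |f x| * ‖p‖ ≤ ‖x‖ := by
    rw [hfx, abs_mul, abs_of_pos (by positivity)]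
    calc (‖p‖ ^ 2)⁻¹ * |inner ℝ p x| * ‖p‖ ≤ (‖p‖ ^ 2)⁻¹ * (‖p‖ * ‖x‖) * ‖p‖ := by
          gcongr
          exact abs_real_inner_le_norm p x
      _ = ‖x‖ := by field_simp
  have happ (x : E) : (T • LinearMap.transvection f ((c - 1) • p)) x
      = T • (x + f x • (c - 1) • p) := by
    simp [LinearMap.transvection.apply]
  refine ⟨T • LinearMap.transvection f ((c - 1) • p), ?_, ?_, fun x ↦ ?_⟩
  · rw [LinearMap.det_smul, LinearMap.transvection.det, map_smul, hfp, hc]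
    simp [hT0.ne']
  · have hp' : T • (p + f p • (c - 1) • p) = (T * c) • p := by
      rw [hfp]
      module
    rw [happ, hp', norm_smul, Real.norm_of_nonneg (by positivity)]
    gcongr
  · rw [happ, norm_smul, Real.norm_of_nonneg hT0.le, mul_comm 2 T, mul_assoc]
    gcongr
    calc ‖x + f x • (c - 1) • p‖ ≤ ‖x‖ + ‖f x • (c - 1) • p‖ := norm_add_le _ _
      _ = ‖x‖ + |1 - c| * (|f x| * ‖p‖) := by
          rw [norm_smul, norm_smul, Real.norm_eq_abs, Real.norm_eq_abs, abs_sub_comm]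
          ring
      _ ≤ ‖x‖ + 1 * ‖x‖ := by
          gcongr
          · rw [abs_of_nonneg] <;> linarith
          · exact hf x
      _ = 2 * ‖x‖ := by ring

variable [MeasurableSpace E] [BorelSpace E]

/-- In positive dimension, some radius makes every ball have volume one. -/
theorem exists_volume_ball_eq_one [Nontrivial E] :
    ∃ r : ℝ, 0 < r ∧ ∀ x : E, volume (ball x r) = 1 := by
  set v := volume (ball (0 : E) 1) with hv
  have hv0 : v ≠ 0 := (measure_ball_pos volume 0 one_pos).ne'
  have hvt : v ≠ ⊤ := measure_ball_lt_top.ne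
  have hvpos : 0 < v.toReal := ENNReal.toReal_pos hv0 hvt
  have hd : finrank ℝ E ≠ 0 := finrank_pos.ne'
  refine ⟨v.toReal⁻¹ ^ ((finrank ℝ E : ℝ)⁻¹), by positivity, fun x ↦ ?_⟩
  rw [Measure.addHaar_ball volume x (by positivity), Real.rpow_inv_natCast_pow (by positivity) hd,
    ENNReal.ofReal_inv_of_pos hvpos, ENNReal.ofReal_toReal hvt]
  exact ENNReal.inv_mul_cancel hv0 hvt

/-- A set meeting every convex set of volume one. -/
def IsDanzer (Y : Set E) : Prop :=
  ∀ K : Set E, Convex ℝ K → volume K = 1 → (K ∩ Y).Nonempty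

theorem convex_volume_preimage_of_det_eq_one {h : E →ₗ[ℝ] E} (hh : LinearMap.det h = 1) {K : Set E}
    (hK : Convex ℝ K) (hvol : volume K = 1) : Convex ℝ (h ⁻¹' K) ∧ volume (h ⁻¹' K) = 1 :=
  ⟨hK.linear_preimage h, by simp [Measure.addHaar_preimage_linearMap, hh, hvol]⟩

theorem IsDanzer.image {Y : Set E} (hY : IsDanzer Y) {h : E →ₗ[ℝ] E} (hh : LinearMap.det h = 1) :
    IsDanzer (h '' Y) := by
  intro K hK hvol
  obtain ⟨hK', hvol'⟩ := convex_volume_preimage_of_det_eq_one hh hK hvol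
  obtain ⟨x, hxK, hxY⟩ := hY _ hK' hvol'
  exact ⟨h x, hxK, mem_image_of_mem h hxY⟩

/-- Any number of points of a Danzer set can be moved close to the origin by a linear map of
determinant one. -/
theorem IsDanzer.exists_le_encard_ball_inter_image (hd : 2 ≤ finrank ℝ E) {Y : Set E}
    (hY : IsDanzer Y) (k : ℕ) {r : ℝ} (hr : 0 < r) :
    ∃ h : E →ₗ[ℝ] E, LinearMap.det h = 1 ∧ k ≤ (ball 0 r ∩ h '' Y).encard := by
  have : Nontrivial E := nontrivial_of_finrank_pos (R := ℝ) (by omega)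
  induction k generalizing r with
  | zero => exact ⟨LinearMap.id, by simp, by simp⟩
  | succ k ih =>
    obtain ⟨ρ, hρ, hball⟩ := exists_volume_ball_eq_one (E := E)
    obtain ⟨c, hc⟩ := exists_norm_eq E (show 0 ≤ ρ + 1 by linarith)
    set T : ℝ := max 1 ((2 * ρ + 1) / r) with hT
    have hT1 : 1 ≤ T := le_max_left _ _
    have hTr : (2 * ρ + 1) ≤ T * r := (div_le_iff₀ hr).mp (le_max_right _ _)
    obtain ⟨g, hg, hcard⟩ := ih (r := min 1 (r / (2 * T))) (by positivity)
    obtain ⟨p, hpc, hpY⟩ := hY.image hg (ball c ρ) (convex_ball c ρ) (hball c)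
    rw [mem_ball, dist_eq_norm] at hpc
    have hp1 : 1 < ‖p‖ := by
      have := norm_sub_norm_le c p
      rw [norm_sub_rev] at this
      linarith
    have hp2 : ‖p‖ < 2 * ρ + 1 := by
      have := norm_sub_norm_le p c
      linarith
    obtain ⟨h, hh, hhp, hhx⟩ := exists_linearMap_det_eq_one_contracting hd
      (norm_pos_iff.mp (by linarith : 0 < ‖p‖)) hT1
    refine ⟨h ∘ₗ g, by rw [LinearMap.det_comp, hh, hg, one_mul], ?_⟩
    have hpmem : p ∉ ball 0 (min 1 (r / (2 * T))) ∩ g '' Y := by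
      rintro ⟨hp, -⟩
      rw [mem_ball_zero_iff, lt_min_iff] at hp
      linarith [hp.1]
    have hinj : Function.Injective h := by
      have := (LinearMap.equivOfDetNeZero h (by simp [hh])).injective
      exact this
    calc ((k + 1 : ℕ) : ℕ∞) ≤ (ball 0 (min 1 (r / (2 * T))) ∩ g '' Y).encard + 1 := by
          push_cast
          gcongr
      _ = (h '' insert p (ball 0 (min 1 (r / (2 * T))) ∩ g '' Y)).encard := by
          rw [hinj.encard_image, encard_insert_of_notMem hpmem]
      _ ≤ (ball 0 r ∩ (h ∘ₗ g) '' Y).encard := by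
          apply encard_le_encard
          rw [LinearMap.coe_comp, image_comp]
          rintro _ ⟨x, rfl | ⟨hx, hxY⟩, rfl⟩
          · refine ⟨mem_ball_zero_iff.mpr ?_, mem_image_of_mem h hpY⟩
            calc ‖h x‖ ≤ T⁻¹ * ‖x‖ := hhp
              _ < T⁻¹ * (T * r) := by gcongr; linarith
              _ = r := by field_simp
          · refine ⟨mem_ball_zero_iff.mpr ?_, mem_image_of_mem h hxY⟩
            rw [mem_ball_zero_iff, lt_min_iff] at hx
            calc ‖h x‖ ≤ 2 * T * ‖x‖ := hhx x
              _ < 2 * T * (r / (2 * T)) := by gcongr; exact hx.2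
              _ = r := by field_simp

/-- A Danzer set has arbitrarily many points in convex sets of volume one. -/
theorem IsDanzer.exists_convex_le_encard (hd : 2 ≤ finrank ℝ E) {Y : Set E} (hY : IsDanzer Y)
    (k : ℕ) : ∃ K : Set E, Convex ℝ K ∧ volume K = 1 ∧ k ≤ (K ∩ Y).encard := by
  have : Nontrivial E := nontrivial_of_finrank_pos (R := ℝ) (by omega)
  obtain ⟨ρ, hρ, hball⟩ := exists_volume_ball_eq_one (E := E)
  obtain ⟨h, hh, hcard⟩ := hY.exists_le_encard_ball_inter_image hd k hρ
  obtain ⟨hconv, hvol⟩ := convex_volume_preimage_of_det_eq_one hh (convex_ball 0 ρ) (hball 0)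
  refine ⟨_, hconv, hvol, hcard.trans ?_⟩
  rw [inter_comm, ← image_inter_preimage, inter_comm]
  exact encard_image_le _ _

end GowersSet

/-- Negative answer to Gowers' question: there is no `Y ⊆ ℝ^d` (`d ≥ 2`) and `C > 0` such
that every convex set of volume one contains at least one and at most `C` points of `Y`. -/
theorem no_gowers_set {d : ℕ} (hd : 2 ≤ d) :
    ¬ ∃ (Y : Set (EuclideanSpace ℝ (Fin d))) (C : ℕ), 0 < C ∧
      ∀ K : Set (EuclideanSpace ℝ (Fin d)), Convex ℝ K → volume K = 1 →
        1 ≤ (K ∩ Y).encard ∧ (K ∩ Y).encard ≤ C := by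
  rintro ⟨Y, C, -, hY⟩
  have hDanzer : IsDanzer Y := fun K hK hvol ↦ one_le_encard_iff_nonempty.mp (hY K hK hvol).1
  obtain ⟨K, hK, hvol, hcard⟩ := hDanzer.exists_convex_le_encard (by simpa using hd) (C + 1)
  have : C + 1 ≤ C := by exact_mod_cast hcard.trans (hY K hK hvol).2
  omega
end

section
/- Suppose Y ⊆ R^d is a Danzer set with volume parameter s. Then for every n ∈ N there exists a convex set K_n with Vol(K_n) = s, 0 ∈ K_n, #(Y ∩ K_n) ≥ n, and diam(K_n) ≤ C_{d,s} · 4^{d^n/(d-1)^{n-1}}, where C_{d,s} is the diameter of a ball of volume s in R^d. -/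
open Metric MeasureTheory Set

/-- `Y` meets every closed convex set of volume `s`. -/
def IsDanzerSet {E : Type*} [NormedAddCommGroup E] [NormedSpace ℝ E] [MeasureSpace E]
    (s : ℝ) (Y : Set E) : Prop :=
  ∀ K : Set E, IsClosed K → Convex ℝ K → volume K = ENNReal.ofReal s → (K ∩ Y).Nonempty

/-- The linear map scaling the direction of `u` by `b` and its orthogonal complement by `a`. -/
theorem exists_axial_stretch {E : Type*} [NormedAddCommGroup E] [InnerProductSpace ℝ E]
    [FiniteDimensional ℝ E] {u : E} (hu : ‖u‖ = 1) {a b : ℝ} (ha : 0 < a) (hab : a ≤ b) :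
    ∃ h : E ≃L[ℝ] E, h u = b • u ∧
      LinearMap.det (h : E →ₗ[ℝ] E) = a ^ Module.finrank ℝ E * (b / a) ∧
      ∀ x, a * ‖x‖ ≤ ‖h x‖ ∧ ‖h x‖ ≤ b * ‖x‖ := by
  have hb : 0 < b := ha.trans_le hab
  have huu : inner ℝ u u = (1 : ℝ) := by simp [hu]
  let f : E →ₗ[ℝ] E := a • LinearMap.transvection ((b / a - 1) • innerₗ E u) u
  have hf (x : E) : f x = a • x + ((b - a) * inner ℝ u x) • u := by
    have : a * ((b / a - 1) * inner ℝ u x) = (b - a) * inner ℝ u x := by field_simp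
    simp [f, LinearMap.transvection.apply, smul_smul, this]
  have hdet : LinearMap.det f = a ^ Module.finrank ℝ E * (b / a) := by
    simp [f, LinearMap.det_smul, hu]
  have hdet0 : LinearMap.det f ≠ 0 := by rw [hdet]; positivity
  have hnorm (x : E) : ‖f x‖ ^ 2 = a ^ 2 * ‖x‖ ^ 2 + (b ^ 2 - a ^ 2) * inner ℝ u x ^ 2 := by
    rw [hf, norm_add_sq_real, norm_smul, norm_smul, hu, real_inner_smul_left,
      real_inner_smul_right, real_inner_comm, mul_pow, mul_one, Real.norm_eq_abs,
      Real.norm_eq_abs, sq_abs, sq_abs]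
    ring
  refine ⟨(f.equivOfDetNeZero hdet0).toContinuousLinearEquiv, ?_, hdet, fun x ↦ ?_⟩
  · change f u = _
    rw [hf, huu, ← add_smul]
    congr 1
    ring
  · change a * ‖x‖ ≤ ‖f x‖ ∧ ‖f x‖ ≤ b * ‖x‖
    have hcs : inner ℝ u x ^ 2 ≤ ‖x‖ ^ 2 := by
      rw [← sq_abs]
      have := abs_real_inner_le_norm u x
      rw [hu, one_mul] at this
      gcongr
    have hba : 0 ≤ b ^ 2 - a ^ 2 := sub_nonneg.2 (by gcongr)
    constructor
    · refine le_of_sq_le_sq ?_ (norm_nonneg _)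
      rw [hnorm, mul_pow]
      nlinarith [sq_nonneg (inner ℝ u x)]
    · refine le_of_sq_le_sq ?_ (by positivity)
      rw [hnorm, mul_pow]
      nlinarith [sq_nonneg (inner ℝ u x)]

theorem IsDanzerSet.preimage {E : Type*} [NormedAddCommGroup E] [NormedSpace ℝ E]
    [MeasureSpace E] {s : ℝ} {Y : Set E} (hY : IsDanzerSet s Y)
    (h : E ≃L[ℝ] E) (hvol : ∀ K : Set E, volume (h '' K) = volume K) :
    IsDanzerSet s (h ⁻¹' Y) := by
  intro K hKc hK hKs
  obtain ⟨-, ⟨x, hx, rfl⟩, hxY⟩ := hY (h '' K) (h.toHomeomorph.isClosedMap K hKc)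
    (hK.linear_image (h : E →ₗ[ℝ] E)) ((hvol K).trans hKs)
  exact ⟨x, hx, hxY⟩

/-- The set in the conclusion also contains the closed ball of radius `ρ` around `0`; counting only
points of `Y` off that ball keeps the points found at successive steps distinct. -/
def HasCrowdedConvexSet {E : Type*} [NormedAddCommGroup E] [NormedSpace ℝ E] [MeasureSpace E]
    (s : ℝ) (Y : Set E) (n : ℕ) (ρ D : ℝ) : Prop :=
  ∃ K : Set E, Convex ℝ K ∧ volume K = ENNReal.ofReal s ∧ closedBall 0 ρ ⊆ K ∧
    (n : ℕ∞) ≤ ((Y ∩ K) \ closedBall 0 ρ).encard ∧ ∀ x ∈ K, ∀ y ∈ K, dist x y ≤ D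

theorem HasCrowdedConvexSet.succ_of_stretch {E : Type*} [NormedAddCommGroup E]
    [NormedSpace ℝ E] [MeasureSpace E] {s : ℝ} {Y : Set E} {n : ℕ}
    {ρ D a b : ℝ} (ha : 0 < a) (hb : 0 < b) (h : E ≃L[ℝ] E)
    (hvol : ∀ K : Set E, volume (h '' K) = volume K)
    (hnorm : ∀ x, a * ‖x‖ ≤ ‖h x‖ ∧ ‖h x‖ ≤ b * ‖x‖)
    (hK : HasCrowdedConvexSet s (h ⁻¹' Y) n ρ D)
    {y : E} (hy : y ∈ Y) (hyρ : a * ρ < ‖y‖) (hhy : ‖h.symm y‖ ≤ ρ) :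
    HasCrowdedConvexSet s Y (n + 1) (a * ρ) (b * D) := by
  obtain ⟨K, hKc, hKs, hKball, hKn, hKd⟩ := hK
  refine ⟨h '' K, hKc.linear_image (h : E →ₗ[ℝ] E), (hvol K).trans hKs, fun x hx ↦ ?_, ?_, ?_⟩
  · refine ⟨h.symm x, hKball ?_, h.apply_symm_apply x⟩
    rw [mem_closedBall_zero_iff] at hx ⊢
    have := (hnorm (h.symm x)).1
    rw [h.apply_symm_apply] at this
    exact le_of_mul_le_mul_left (this.trans hx) ha
  · have hsub : insert y (h '' ((h ⁻¹' Y ∩ K) \ closedBall 0 ρ)) ⊆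
        (Y ∩ h '' K) \ closedBall 0 (a * ρ) := by
      rintro z (rfl | ⟨x, ⟨⟨hxY, hxK⟩, hxρ⟩, rfl⟩)
      · refine ⟨⟨hy, h.symm z, hKball (by simpa using hhy), h.apply_symm_apply z⟩, ?_⟩
        simpa using hyρ
      · refine ⟨⟨hxY, x, hxK, rfl⟩, ?_⟩
        rw [mem_closedBall_zero_iff, not_le] at hxρ ⊢
        exact (mul_lt_mul_of_pos_left hxρ ha).trans_le (hnorm x).1
    have hmem : y ∉ h '' ((h ⁻¹' Y ∩ K) \ closedBall 0 ρ) := by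
      rintro ⟨x, ⟨-, hxρ⟩, rfl⟩
      rw [h.symm_apply_apply] at hhy
      exact hxρ (by simpa using hhy)
    refine le_trans ?_ (encard_le_encard hsub)
    rw [encard_insert_of_notMem hmem, h.injective.encard_image]
    push_cast
    gcongr
  · rintro - ⟨x, hx, rfl⟩ - ⟨z, hz, rfl⟩
    rw [dist_eq_norm, ← map_sub]
    refine (hnorm _).2.trans ?_
    rw [← dist_eq_norm]
    gcongr
    exact hKd x hx z hz

theorem IsDanzerSet.hasCrowdedConvexSet {E : Type*} [NormedAddCommGroup E]
    [InnerProductSpace ℝ E] [FiniteDimensional ℝ E] [MeasurableSpace E] [BorelSpace E]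
    {q s r : ℝ} (hd : 2 ≤ Module.finrank ℝ E)
    (hq : q = Module.finrank ℝ E / ((Module.finrank ℝ E : ℝ) - 1)) (hr : 0 < r)
    (hball : ∀ c : E, volume (closedBall c r) = ENNReal.ofReal s) (n : ℕ) :
    ∀ Y : Set E, IsDanzerSet s Y → HasCrowdedConvexSet s Y n (4 * r * 4 ^ (-q ^ n))
      (2 * r * 4 ^ (((Module.finrank ℝ E : ℝ) - 1) * (q ^ n - 1))) := by
  set d := Module.finrank ℝ E with hd_def
  have hd' : (2 : ℝ) ≤ d := by exact_mod_cast hd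
  have hd1 : 0 < (d : ℝ) - 1 := by linarith
  have hd1' : (d : ℝ) - 1 ≠ 0 := hd1.ne'
  have hq1 : 1 ≤ q := by rw [hq, one_le_div hd1]; linarith
  have hqd : q * (d - 1) = d := by rw [hq]; field_simp
  induction n with
  | zero =>
    intro Y _
    refine ⟨closedBall 0 r, convex_closedBall 0 r, hball 0, ?_, by simp, fun x hx y hy ↦ ?_⟩
    · refine closedBall_subset_closedBall (le_of_eq ?_)
      rw [pow_zero, Real.rpow_neg_one]
      ring
    · have := dist_triangle_right x y 0
      rw [mem_closedBall] at hx hy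
      simp only [pow_zero, sub_self, mul_zero, Real.rpow_zero, mul_one]
      linarith
  | succ n ih =>
    intro Y hY
    have hqn : 1 ≤ q ^ n := one_le_pow₀ hq1
    have hqn_div : q ^ n / (d - 1) * (d - 1) = q ^ n := div_mul_cancel₀ _ hd1'
    have : Nontrivial E := Module.nontrivial_of_finrank_pos (R := ℝ) (by omega)
    obtain ⟨c, hc⟩ := exists_norm_eq E (c := 3 * r) (by positivity)
    obtain ⟨y, hyc, hy⟩ := hY _ isClosed_closedBall (convex_closedBall c r) (hball c)
    rw [mem_closedBall, dist_eq_norm] at hyc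
    have hy2 : 2 * r ≤ ‖y‖ := by
      have := norm_sub_norm_le c y
      rw [norm_sub_rev] at this
      linarith
    have hy4 : ‖y‖ ≤ 4 * r := by
      have := norm_sub_norm_le y c
      linarith
    have hy0 : 0 < ‖y‖ := by linarith
    set a : ℝ := 4 ^ (-(q ^ n / (d - 1))) with ha_def
    set b : ℝ := 4 ^ q ^ n with hb_def
    have ha : 0 < a := by positivity
    have hb : 0 < b := by positivity
    have ha1 : a ≤ 1 := Real.rpow_le_one_of_one_le_of_nonpos (by norm_num)
      (neg_nonpos.2 (by positivity))
    have hb1 : 1 ≤ b := Real.one_le_rpow (by norm_num) (by positivity)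
    have hu : ‖‖y‖⁻¹ • y‖ = 1 := by
      rw [norm_smul, norm_inv, norm_norm, inv_mul_cancel₀ hy0.ne']
    obtain ⟨h, hhu, hdet, hnorm⟩ := exists_axial_stretch hu ha (ha1.trans hb1)
    have hdet1 : LinearMap.det (h : E →ₗ[ℝ] E) = 1 := by
      rw [hdet, ← hd_def, ← Real.rpow_natCast, ha_def, hb_def, ← Real.rpow_mul (by norm_num),
        ← Real.rpow_sub (by norm_num), ← Real.rpow_add (by norm_num), ← Real.rpow_zero 4]
      congr 1
      linear_combination -hqn_div
    have hvol (K : Set E) : volume (h '' K) = volume K := by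
      rw [Measure.addHaar_image_continuousLinearEquiv, hdet1]
      simp
    have hhy : h y = b • y := by
      rw [map_smul, smul_comm] at hhu
      exact smul_right_injective E (inv_ne_zero hy0.ne') hhu
    have hρ : a * (4 * r * 4 ^ (-q ^ n)) = 4 * r * 4 ^ (-q ^ (n + 1)) := by
      rw [mul_left_comm, ha_def, ← Real.rpow_add (by norm_num)]
      congr 2
      linear_combination q ^ n / (d - 1) * hqd + (1 - q) * hqn_div
    have hD : b * (2 * r * 4 ^ (((d : ℝ) - 1) * (q ^ n - 1))) =
        2 * r * 4 ^ (((d : ℝ) - 1) * (q ^ (n + 1) - 1)) := by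
      rw [mul_left_comm, hb_def, ← Real.rpow_add (by norm_num)]
      congr 2
      linear_combination - q ^ n * hqd
    rw [← hρ, ← hD]
    refine HasCrowdedConvexSet.succ_of_stretch ha hb h hvol hnorm (ih _ (hY.preimage h hvol)) hy
      ?_ ?_
    · have h4 : (4 : ℝ) ^ (-q ^ n) ≤ 4 ^ (-1 : ℝ) :=
        Real.rpow_le_rpow_of_exponent_le (by norm_num) (by linarith)
      rw [Real.rpow_neg_one] at h4
      have h5 : 4 * r * (4 : ℝ) ^ (-q ^ n) ≤ r := by nlinarith
      have h6 : 0 ≤ 4 * r * (4 : ℝ) ^ (-q ^ n) := by positivity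
      nlinarith
    · have : h.symm y = b⁻¹ • y := by
        rw [ContinuousLinearEquiv.symm_apply_eq, map_smul, hhy, inv_smul_smul₀ hb.ne']
      rw [this, norm_smul, norm_inv, Real.norm_of_nonneg hb.le, Real.rpow_neg (by norm_num),
        mul_comm]
      gcongr

/-- Quantitative version: if `Y` is a Danzer set with volume parameter `s`, then for each `n`
there is a convex set `Kₙ` of volume `s` containing `0` and at least `n` points of `Y`, with
`diam(Kₙ) ≤ C_{d,s} · 4^{d^n/(d-1)^{n-1}}`, where `C_{d,s} = 2 (s/β_d)^{1/d}` is the diameter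
of a ball of volume `s` in `ℝ^d`. -/
theorem quantitative_danzer {d : ℕ} (hd : 2 ≤ d) (s : ℝ) (hs : 0 < s)
    (Y : Set (EuclideanSpace ℝ (Fin d)))
    (hDanzer : ∀ K : Set (EuclideanSpace ℝ (Fin d)), IsClosed K → Convex ℝ K →
      volume K = ENNReal.ofReal s → (K ∩ Y).Nonempty)
    (n : ℕ) (hn : 1 ≤ n) :
    ∃ K : Set (EuclideanSpace ℝ (Fin d)), Convex ℝ K ∧
      volume K = ENNReal.ofReal s ∧ (0 : EuclideanSpace ℝ (Fin d)) ∈ K ∧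
      (n : ℕ∞) ≤ (Y ∩ K).encard ∧
      diam K ≤ (2 * (s / (volume (closedBall (0 : EuclideanSpace ℝ (Fin d)) 1)).toReal)
          ^ ((1 : ℝ) / d)) * 4 ^ ((d : ℝ) ^ n / ((d : ℝ) - 1) ^ (n - 1)) := by
  set r : ℝ := (s / (volume (closedBall (0 : EuclideanSpace ℝ (Fin d)) 1)).toReal) ^ ((1 : ℝ) / d)
    with hr_def
  have hβ : 0 < (volume (closedBall (0 : EuclideanSpace ℝ (Fin d)) 1)).toReal :=
    ENNReal.toReal_pos (measure_closedBall_pos volume _ one_pos).ne' measure_closedBall_lt_top.ne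
  have hr : 0 < r := by positivity
  have hball (c : EuclideanSpace ℝ (Fin d)) : volume (closedBall c r) = ENNReal.ofReal s := by
    have hpow : r ^ d = s / (volume (closedBall (0 : EuclideanSpace ℝ (Fin d)) 1)).toReal := by
      rw [hr_def, one_div, Real.rpow_inv_natCast_pow (by positivity) (by omega)]
    rw [Measure.addHaar_closedBall' _ _ hr.le, finrank_euclideanSpace_fin, hpow,
      ← ENNReal.ofReal_toReal (measure_closedBall_lt_top (μ := volume)
        (x := (0 : EuclideanSpace ℝ (Fin d))) (r := 1)).ne, ← ENNReal.ofReal_mul (by positivity),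
      ENNReal.toReal_ofReal hβ.le, div_mul_cancel₀ _ hβ.ne']
  have hfin : Module.finrank ℝ (EuclideanSpace ℝ (Fin d)) = d := finrank_euclideanSpace_fin
  obtain ⟨K, hKc, hKs, hKball, hKn, hKd⟩ := IsDanzerSet.hasCrowdedConvexSet (by rwa [hfin]) rfl hr
    hball n Y hDanzer
  refine ⟨K, hKc, hKs, hKball (mem_closedBall_self (by positivity)),
    hKn.trans (encard_le_encard sdiff_subset),
    (diam_le_of_forall_dist_le (by positivity) hKd).trans ?_⟩
  have hd' : (2 : ℝ) ≤ d := by exact_mod_cast hd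
  have hd1 : 0 < (d : ℝ) - 1 := by linarith
  have hd1' : (d : ℝ) - 1 ≠ 0 := hd1.ne'
  rw [hfin]
  gcongr
  · norm_num
  · obtain ⟨m, rfl⟩ := Nat.exists_eq_add_of_le' hn
    have : ((d : ℝ) - 1) * (d / (d - 1)) ^ (m + 1) = d ^ (m + 1) / (d - 1) ^ m := by
      rw [div_pow, pow_succ ((d : ℝ) - 1), ← mul_div_assoc, mul_comm ((d : ℝ) - 1) (_ ^ _),
        mul_div_mul_right _ _ hd1']
    rw [mul_sub, this, Nat.add_sub_cancel]
    linarith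
end

section
/- For every ε ∈ (0,1), if N ⊆ [0,1]^d intersects every convex subset of [0,1]^d of volume ε, then there exists a convex set K ⊆ [0,1]^d of volume ε with #(N ∩ K) ≥ c_d · log log(1/ε) for some constant c_d > 0 depending only on d. -/
open Metric MeasureTheory Set

/-- The unit cube `[0,1]^d`. -/
def unitCube (d : ℕ) : Set (EuclideanSpace ℝ (Fin d)) :=
  {x | ∀ i, x i ∈ Set.Icc (0 : ℝ) 1}

/-- Stretching by the factor `‖x‖` along `x`. -/
lemma exists_stretch {V : Type*} [NormedAddCommGroup V] [InnerProductSpace ℝ V]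
    [FiniteDimensional ℝ V] (x : V) (hx : 1 < ‖x‖) :
    ∃ S : V →L[ℝ] V, S.det = ‖x‖ ∧ ‖S‖ ≤ ‖x‖ ∧
      closedBall 0 1 ⊆ S '' closedBall 0 1 ∧ x ∈ S '' closedBall 0 1 := by
  set n := ‖x‖ with hn
  have hn0 : 0 < n := by linarith
  obtain ⟨u, hu, hux⟩ : ∃ u : V, ‖u‖ = 1 ∧ n • u = x := by
    refine ⟨n⁻¹ • x, ?_, ?_⟩
    · rw [norm_smul, norm_inv, Real.norm_of_nonneg hn0.le, ← hn, inv_mul_cancel₀ hn0.ne']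
    · rw [smul_smul, mul_inv_cancel₀ hn0.ne', one_smul]
  have huu : inner ℝ u u = (1 : ℝ) := by rw [real_inner_self_eq_norm_sq, hu]; norm_num
  have hS : ∀ y, (ContinuousLinearMap.id ℝ V +
      ((n - 1) • innerSL ℝ u).smulRight u) y = y + ((n - 1) * inner ℝ u y) • u := by
    intro y; simp
  refine ⟨ContinuousLinearMap.id ℝ V + ((n - 1) • innerSL ℝ u).smulRight u, ?_, ?_, ?_, ?_⟩
  · have h : ((ContinuousLinearMap.id ℝ V + ((n - 1) • innerSL ℝ u).smulRight u :
        V →L[ℝ] V) : V →ₗ[ℝ] V) =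
        LinearMap.transvection (((n - 1) • innerSL ℝ u : V →L[ℝ] ℝ) : V →ₗ[ℝ] ℝ) u := by
      ext y; simp [LinearMap.transvection]
    rw [ContinuousLinearMap.det, h, LinearMap.transvection.det]
    simp [hu]
  · refine ContinuousLinearMap.opNorm_le_bound _ hn0.le fun y => ?_
    rw [hS]
    have h1 : ‖((n - 1) * inner ℝ u y) • u‖ ≤ (n - 1) * ‖y‖ := by
      rw [norm_smul, hu, mul_one, norm_mul, Real.norm_of_nonneg (by linarith)]
      have := norm_inner_le_norm (𝕜 := ℝ) u y
      rw [hu, one_mul] at this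
      exact mul_le_mul_of_nonneg_left this (by linarith)
    linarith [norm_add_le y (((n - 1) * inner ℝ u y) • u)]
  · intro y hy
    rw [mem_closedBall_zero_iff] at hy
    refine ⟨y - ((1 - n⁻¹) * inner ℝ u y) • u, ?_, ?_⟩
    · rw [mem_closedBall_zero_iff]
      have h2 : ‖y - ((1 - n⁻¹) * inner ℝ u y) • u‖ ^ 2 ≤ ‖y‖ ^ 2 := by
        rw [norm_sub_sq_real, inner_smul_right, norm_smul, hu, mul_one, Real.norm_eq_abs, sq_abs,
          real_inner_comm]
        have h3 : n⁻¹ < 1 := inv_lt_one_of_one_lt₀ hx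
        have h4 : 0 < n⁻¹ := inv_pos.2 hn0
        have h5 : 0 ≤ (1 - n⁻¹) * (1 + n⁻¹) * (inner ℝ u y) ^ 2 :=
          mul_nonneg (mul_nonneg (by linarith) (by linarith)) (sq_nonneg _)
        rw [real_inner_comm y u] at *
        nlinarith
      exact (pow_le_pow_iff_left₀ (norm_nonneg _) (norm_nonneg _) two_ne_zero).1 h2 |>.trans hy
    · rw [hS, inner_sub_right, inner_smul_right, huu, sub_add, ← sub_smul]
      have : (1 - n⁻¹) * inner ℝ u y -
          (n - 1) * (inner ℝ u y - (1 - n⁻¹) * inner ℝ u y * 1) = 0 := by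
        field_simp; ring
      rw [this, zero_smul, sub_zero]
  · refine ⟨u, by simp [hu], ?_⟩
    rw [hS, huu, mul_one, ← hux]
    module

/-- The centre of the unit cube. -/
noncomputable def cubeCenter (d : ℕ) : EuclideanSpace ℝ (Fin d) :=
  WithLp.toLp 2 fun _ => 1 / 2

lemma cubeCenter_add_mem {d : ℕ} {y : EuclideanSpace ℝ (Fin d)} (hy : ‖y‖ ≤ 1 / 2) :
    cubeCenter d + y ∈ unitCube d := by
  intro i
  have h := abs_le.1 ((PiLp.norm_apply_le y i).trans hy)
  simp only [cubeCenter, PiLp.add_apply, mem_Icc]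
  constructor <;> linarith [h.1, h.2]

/-- The convex sets of the argument: affine images of `B` centred at the centre of the cube. -/
noncomputable def centeredImage {d : ℕ}
    (A : EuclideanSpace ℝ (Fin d) →L[ℝ] EuclideanSpace ℝ (Fin d))
    (B : Set (EuclideanSpace ℝ (Fin d))) : Set (EuclideanSpace ℝ (Fin d)) :=
  (fun x => cubeCenter d + A x) '' B

section centeredImage

variable {d : ℕ} {A : EuclideanSpace ℝ (Fin d) →L[ℝ] EuclideanSpace ℝ (Fin d)}
  {B : Set (EuclideanSpace ℝ (Fin d))}

lemma centeredImage_eq : centeredImage A B = (cubeCenter d + ·) '' (A '' B) := by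
  rw [centeredImage, image_image]

lemma convex_centeredImage (hB : Convex ℝ B) : Convex ℝ (centeredImage A B) := by
  rw [centeredImage_eq]
  exact (hB.linear_image A.toLinearMap).translate _

lemma volume_centeredImage :
    volume (centeredImage A B) = ENNReal.ofReal |A.det| * volume B := by
  rw [centeredImage_eq, image_add_left, measure_preimage_add,
    Measure.addHaar_image_continuousLinearMap]

lemma centeredImage_subset_unitCube {R : ℝ} (hB : B ⊆ closedBall 0 R) (hA : ‖A‖ * R ≤ 1 / 2) :
    centeredImage A B ⊆ unitCube d := by
  rintro _ ⟨x, hx, rfl⟩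
  refine cubeCenter_add_mem ((A.le_opNorm x).trans (le_trans ?_ hA))
  exact mul_le_mul_of_nonneg_left (mem_closedBall_zero_iff.1 (hB hx)) (norm_nonneg _)

end centeredImage

/-- The volume of the Euclidean unit ball. -/
noncomputable def ballVolume (d : ℕ) : ℝ :=
  (volume (ball (0 : EuclideanSpace ℝ (Fin d)) 1)).toReal

lemma ballVolume_pos (d : ℕ) : 0 < ballVolume d :=
  ENNReal.toReal_pos (measure_ball_pos _ _ one_pos).ne' measure_ball_lt_top.ne

lemma volume_ball_eq {d : ℕ} (x : EuclideanSpace ℝ (Fin d)) {r : ℝ} (hr : 0 < r) :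
    volume (ball x r) = ENNReal.ofReal (r ^ d * ballVolume d) := by
  rw [Measure.addHaar_ball_of_pos _ _ hr, finrank_euclideanSpace_fin,
    ENNReal.ofReal_mul (by positivity), ballVolume, ENNReal.ofReal_toReal measure_ball_lt_top.ne]

lemma volume_closedBall_eq {d : ℕ} (x : EuclideanSpace ℝ (Fin d)) {r : ℝ} (hr : 0 < r) :
    volume (closedBall x r) = ENNReal.ofReal (r ^ d * ballVolume d) := by
  rw [Measure.addHaar_closedBall _ _ hr.le, finrank_euclideanSpace_fin,
    ENNReal.ofReal_mul (by positivity), ballVolume, ENNReal.ofReal_toReal measure_ball_lt_top.ne]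

/-- There is an ellipsoid centred in the cube with volume at most `r * ε` that contains `k` points
of `N` and is not too elongated. -/
def HasThinEllipsoid {d : ℕ} (N : Set (EuclideanSpace ℝ (Fin d))) (ε ρ : ℝ) (k : ℕ) (r : ℝ) :
    Prop :=
  ∃ A : EuclideanSpace ℝ (Fin d) →L[ℝ] EuclideanSpace ℝ (Fin d),
    A.det ≠ 0 ∧ ‖A‖ * ρ ^ (d - 1) ≤ |A.det| ∧ |A.det| * ballVolume d ≤ r * ε ∧
      ∃ S : Finset (EuclideanSpace ℝ (Fin d)),
        ↑S ⊆ N ∩ centeredImage A (closedBall 0 1) ∧ S.card = k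

lemma exists_dilation {d : ℕ} (hd : 2 ≤ d) {ε ρ s ω a : ℝ} (hε : 0 < ε) (hω : 0 < ω)
    (hs : 0 < s) (hρ : ρ ^ (d - 1) * ω = 6 * ε) (has : a * ρ ^ (d - 1) ≤ s)
    (hsε : s * ω ≤ ε) :
    ∃ μ : ℝ, 1 ≤ μ ∧ s * (μ ^ d * ω) = ε ∧ 6 * (a * μ) ≤ 1 := by
  have hd0 : d ≠ 0 := by omega
  have hμ : ((ε / (s * ω)) ^ ((d : ℝ)⁻¹)) ^ d = ε / (s * ω) :=
    Real.rpow_inv_natCast_pow (by positivity) hd0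
  set μ := (ε / (s * ω)) ^ ((d : ℝ)⁻¹)
  have hμ0 : 0 ≤ μ := by positivity
  have hμ1 : 1 ≤ μ := by
    rw [← one_le_pow_iff_of_nonneg hμ0 hd0, hμ, one_le_div (by positivity)]
    exact hsε
  have hμε : s * (μ ^ d * ω) = ε := by rw [hμ]; field_simp
  refine ⟨μ, hμ1, hμε, ?_⟩
  have h1 : a * μ * (6 * ε) ≤ ε := by
    calc a * μ * (6 * ε) = a * ρ ^ (d - 1) * (μ * ω) := by rw [← hρ]; ring
      _ ≤ s * (μ ^ d * ω) := by
        gcongr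
        exact le_self_pow₀ hμ1 hd0
      _ = ε := hμε
  nlinarith

lemma HasThinEllipsoid.exists_convex {d : ℕ} (hd : 2 ≤ d) {N : Set (EuclideanSpace ℝ (Fin d))}
    {ε ρ r : ℝ} {k : ℕ} (hε : 0 < ε) (hρ : ρ ^ (d - 1) * ballVolume d = 6 * ε) (hr : r ≤ 1)
    (h : HasThinEllipsoid N ε ρ k r) :
    ∃ K : Set (EuclideanSpace ℝ (Fin d)), K ⊆ unitCube d ∧ Convex ℝ K ∧
      volume K = ENNReal.ofReal ε ∧
      ∃ S : Finset (EuclideanSpace ℝ (Fin d)), ↑S ⊆ N ∩ K ∧ S.card = k := by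
  obtain ⟨A, hA, hAρ, hAr, S, hS, hk⟩ := h
  obtain ⟨μ, hμ1, hμε, hAμ⟩ := exists_dilation hd hε (ballVolume_pos d) (abs_pos.2 hA)
    hρ hAρ (hAr.trans (mul_le_of_le_one_left hε.le hr))
  refine ⟨centeredImage A (closedBall 0 μ),
    centeredImage_subset_unitCube subset_rfl (by linarith),
    convex_centeredImage (convex_closedBall _ _), ?_, S, ?_, hk⟩
  · rw [volume_centeredImage, volume_closedBall_eq _ (by linarith),
      ← ENNReal.ofReal_mul (abs_nonneg _), hμε]
  · exact hS.trans (inter_subset_inter_right _ (image_mono (closedBall_subset_closedBall hμ1)))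

lemma HasThinEllipsoid.step {d : ℕ} (hd : 2 ≤ d) {N : Set (EuclideanSpace ℝ (Fin d))}
    {ε ρ τ : ℝ} {k : ℕ} (hε : 0 < ε) (hρ : ρ ^ (d - 1) * ballVolume d = 6 * ε)
    (hN : ∀ K : Set (EuclideanSpace ℝ (Fin d)), K ⊆ unitCube d → Convex ℝ K →
      volume K = ENNReal.ofReal ε → (N ∩ K).Nonempty)
    (hτ : 0 < τ) (hτ1 : 3 ^ d * τ ≤ 1) (h : HasThinEllipsoid N ε ρ k (3 ^ d * τ ^ 2)) :
    HasThinEllipsoid N ε ρ (k + 1) (3 ^ d * τ) := by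
  classical
  obtain ⟨A, hA, hAρ, hAr, S, hS, hk⟩ := h
  have hω := ballVolume_pos d
  have hτ' : τ ≤ 1 := by
    have : (1 : ℝ) ≤ 3 ^ d := one_le_pow₀ (by norm_num)
    nlinarith
  have hr : 3 ^ d * τ ^ 2 ≤ 1 := by nlinarith
  obtain ⟨μ, hμ1, hμε, hAμ⟩ := exists_dilation hd hε hω (abs_pos.2 hA)
    hρ hAρ (hAr.trans (mul_le_of_le_one_left hε.le hr))
  have : NeZero d := ⟨by omega⟩
  obtain ⟨e, he⟩ : ∃ e : EuclideanSpace ℝ (Fin d), ‖e‖ = 2 * μ :=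
    ⟨EuclideanSpace.single 0 (2 * μ), by
      rw [PiLp.norm_single, Real.norm_of_nonneg (by linarith)]⟩
  have hball : ∀ x ∈ ball e μ, μ < ‖x‖ ∧ ‖x‖ < 3 * μ := by
    intro x hx
    rw [mem_ball, dist_eq_norm] at hx
    have h1 := abs_le.1 (abs_norm_sub_norm_le x e)
    constructor <;> linarith [h1.1, h1.2]
  obtain ⟨_, hpN, x, hx, rfl⟩ := hN (centeredImage A (ball e μ))
    (centeredImage_subset_unitCube (R := 3 * μ)
      (fun x hx => mem_closedBall_zero_iff.2 (hball x hx).2.le) (by linarith))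
    (convex_centeredImage (convex_ball _ _))
    (by rw [volume_centeredImage, volume_ball_eq _ (by linarith),
      ← ENNReal.ofReal_mul (abs_nonneg _), hμε])
  obtain ⟨hx1, hx3⟩ := hball x hx
  have hx0 : 1 < ‖x‖ := by linarith
  obtain ⟨T, hT, hTn, hTB, hTx⟩ := exists_stretch x hx0
  have hdet : (A.comp T).det = A.det * ‖x‖ := by
    rw [← hT]
    exact LinearMap.det_comp _ _
  have habs : |(A.comp T).det| = |A.det| * ‖x‖ := by rw [hdet, abs_mul, abs_norm]
  have himage : centeredImage (A.comp T) (closedBall 0 1) =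
      centeredImage A (T '' closedBall 0 1) := by
    simp only [centeredImage, image_image, ContinuousLinearMap.comp_apply]
  have hρ0 : 0 ≤ ρ ^ (d - 1) := by
    by_contra! hneg
    nlinarith
  refine ⟨A.comp T, ?_, ?_, ?_, insert (cubeCenter d + A x) S, ?_, ?_⟩
  · rw [hdet]
    exact mul_ne_zero hA (by linarith)
  · rw [habs]
    calc ‖A.comp T‖ * ρ ^ (d - 1) ≤ ‖A‖ * ‖x‖ * ρ ^ (d - 1) := by
          gcongr
          exact (A.opNorm_comp_le T).trans (by gcongr)
      _ = ‖A‖ * ρ ^ (d - 1) * ‖x‖ := by ring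
      _ ≤ |A.det| * ‖x‖ := by gcongr
  · rw [habs]
    obtain ⟨m, rfl⟩ : ∃ m, d = m + 1 := ⟨d - 1, by omega⟩
    set a := |A.det| * ballVolume (m + 1) / ε with ha
    have ha0 : 0 ≤ a := by positivity
    have haμ : a * μ ^ (m + 1) = 1 := by
      rw [ha, div_mul_eq_mul_div, div_eq_one_iff_eq hε.ne', ← hμε]
      ring
    have har : a ≤ 3 ^ (m + 1) * τ ^ 2 := by rwa [ha, div_le_iff₀ hε]
    have hpow : (3 * μ * a) ^ (m + 1) ≤ (3 ^ (m + 1) * τ) ^ (m + 1) := by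
      calc (3 * μ * a) ^ (m + 1) = 3 ^ (m + 1) * (a * μ ^ (m + 1)) * a ^ m := by ring
        _ = 3 ^ (m + 1) * a ^ m := by rw [haμ, mul_one]
        _ ≤ 3 ^ (m + 1) * (3 ^ (m + 1) * τ ^ 2) ^ m := by gcongr
        _ = (3 ^ (m + 1)) ^ (m + 1) * τ ^ (2 * m) := by ring
        _ ≤ (3 ^ (m + 1)) ^ (m + 1) * τ ^ (m + 1) := by
          gcongr ?_ * ?_
          exact pow_le_pow_of_le_one hτ.le hτ' (by omega)
        _ = _ := by rw [mul_pow]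
    have hle := (pow_le_pow_iff_left₀ (by positivity) (by positivity) (by omega)).1 hpow
    calc |A.det| * ‖x‖ * ballVolume (m + 1) = ‖x‖ * a * ε := by rw [ha]; field_simp
      _ ≤ 3 * μ * a * ε := by gcongr
      _ ≤ _ := by gcongr
  · rw [himage, Finset.coe_insert, insert_subset_iff]
    exact ⟨⟨hpN, x, hTx, rfl⟩, hS.trans (inter_subset_inter_right _ (image_mono hTB))⟩
  · rw [Finset.card_insert_of_notMem, hk]
    intro hmem
    obtain ⟨y, hy, hyx⟩ := (hS hmem).2
    have hker : Function.Injective A := by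
      have : IsUnit (LinearMap.det A.toLinearMap) := isUnit_iff_ne_zero.2 hA
      exact ((LinearMap.isUnit_iff_isUnit_det _).2 this |> (Module.End.isUnit_iff _).1).1
    have : y = x := hker (add_left_cancel hyx)
    rw [this, mem_closedBall_zero_iff] at hy
    linarith

lemma hasThinEllipsoid_of_le {d : ℕ} (hd : 2 ≤ d) {N : Set (EuclideanSpace ℝ (Fin d))}
    {ε ρ : ℝ} (hε : 0 < ε) (hρ0 : 0 < ρ) (hρ : ρ ^ (d - 1) * ballVolume d = 6 * ε)
    (hN : ∀ K : Set (EuclideanSpace ℝ (Fin d)), K ⊆ unitCube d → Convex ℝ K →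
      volume K = ENNReal.ofReal ε → (N ∩ K).Nonempty) (k : ℕ) :
    ∀ τ : ℝ, 0 < τ → 3 ^ d * τ ≤ 1 → ρ ≤ τ ^ 2 ^ k →
      HasThinEllipsoid N ε ρ k (3 ^ d * τ) := by
  induction k with
  | zero =>
    intro τ hτ _ hρτ
    rw [pow_zero, pow_one] at hρτ
    have hdet : (ρ • ContinuousLinearMap.id ℝ (EuclideanSpace ℝ (Fin d))).det = ρ ^ d := by
      simp [ContinuousLinearMap.det]
    have hsucc : ρ ^ d = ρ * ρ ^ (d - 1) := by
      rw [← pow_succ', Nat.sub_add_cancel (by omega)]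
    refine ⟨ρ • ContinuousLinearMap.id ℝ _, ?_, ?_, ?_, ∅, by simp, rfl⟩
    · rw [hdet]
      positivity
    · rw [hdet, abs_of_pos (by positivity), hsucc, norm_smul, Real.norm_of_nonneg hρ0.le]
      gcongr
      exact mul_le_of_le_one_right hρ0.le ContinuousLinearMap.norm_id_le
    · rw [hdet, abs_of_pos (by positivity), hsucc, mul_assoc, hρ]
      have h9 : (6 : ℝ) ≤ 3 ^ d :=
        le_trans (by norm_num) (pow_le_pow_right₀ (by norm_num : (1 : ℝ) ≤ 3) hd)
      calc ρ * (6 * ε) = 6 * ρ * ε := by ring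
        _ ≤ 3 ^ d * τ * ε := by gcongr
  | succ k ih =>
    intro τ hτ hτ1 hρτ
    refine HasThinEllipsoid.step hd hε hρ hN hτ hτ1 (ih (τ ^ 2) (by positivity) ?_ ?_)
    · have : (1 : ℝ) ≤ 3 ^ d := one_le_pow₀ (by norm_num)
      nlinarith
    · rwa [← pow_mul, ← pow_succ']

lemma exists_convex_of_log_large {d : ℕ} (hd : 2 ≤ d) :
    ∃ C : ℝ, 1 ≤ C ∧ ∀ ε : ℝ, 0 < ε →
      ∀ N : Set (EuclideanSpace ℝ (Fin d)),
        (∀ K : Set (EuclideanSpace ℝ (Fin d)), K ⊆ unitCube d → Convex ℝ K →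
          volume K = ENNReal.ofReal ε → (N ∩ K).Nonempty) →
        ∀ k : ℕ, C * 2 ^ k ≤ Real.log (1 / ε) →
        ∃ K : Set (EuclideanSpace ℝ (Fin d)), K ⊆ unitCube d ∧ Convex ℝ K ∧
          volume K = ENNReal.ofReal ε ∧
          ∃ S : Finset (EuclideanSpace ℝ (Fin d)), ↑S ⊆ N ∩ K ∧ S.card = k := by
  have hω := ballVolume_pos d
  have hd1 : d - 1 ≠ 0 := by omega
  have hlog3 : 0 < Real.log 3 := Real.log_pos (by norm_num)
  refine ⟨1 + |Real.log (6 / ballVolume d)| + (d - 1 : ℕ) * (d * Real.log 3), ?_, ?_⟩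
  · have : 0 ≤ ((d - 1 : ℕ) : ℝ) * (d * Real.log 3) := by positivity
    linarith [abs_nonneg (Real.log (6 / ballVolume d))]
  intro ε hε N hN k hk
  have hbase : 0 ≤ 6 * ε / ballVolume d := by positivity
  have hρ : ((6 * ε / ballVolume d) ^ (((d - 1 : ℕ) : ℝ)⁻¹)) ^ (d - 1) = 6 * ε / ballVolume d :=
    Real.rpow_inv_natCast_pow hbase hd1
  have hρ0 : 0 < (6 * ε / ballVolume d) ^ (((d - 1 : ℕ) : ℝ)⁻¹) := by positivity
  set ρ := (6 * ε / ballVolume d) ^ (((d - 1 : ℕ) : ℝ)⁻¹)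
  have hρε : ρ ^ (d - 1) * ballVolume d = 6 * ε := by rw [hρ]; field_simp
  have hτ : (3 : ℝ) ^ d * ((3 : ℝ) ^ d)⁻¹ = 1 := mul_inv_cancel₀ (by positivity)
  refine (hasThinEllipsoid_of_le hd hε hρ0 hρε hN k ((3 ^ d)⁻¹) (by positivity) hτ.le
    ?_).exists_convex hd hε hρε hτ.le
  rw [← pow_le_pow_iff_left₀ hρ0.le (by positivity) hd1, hρ,
    ← Real.log_le_log_iff (by positivity) (by positivity), mul_div_right_comm,
    Real.log_mul (by positivity) hε.ne', Real.log_pow, Real.log_pow, Real.log_inv, Real.log_pow]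
  rw [one_div, Real.log_inv] at hk
  push_cast
  have h2 : (1 : ℝ) ≤ 2 ^ k := one_le_pow₀ (by norm_num)
  have h3 := abs_nonneg (Real.log (6 / ballVolume d))
  have h4 := le_abs_self (Real.log (6 / ballVolume d))
  nlinarith

lemma exists_convex_volume_eq {d : ℕ} (hd : d ≠ 0) {ε : ℝ} (hε : ε ∈ Ioo (0 : ℝ) 1) :
    ∃ K : Set (EuclideanSpace ℝ (Fin d)), K ⊆ unitCube d ∧ Convex ℝ K ∧
      volume K = ENNReal.ofReal ε := by
  have ht : (ε ^ ((d : ℝ)⁻¹)) ^ d = ε := Real.rpow_inv_natCast_pow hε.1.le hd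
  have ht0 : 0 ≤ ε ^ ((d : ℝ)⁻¹) := Real.rpow_nonneg hε.1.le _
  have ht1 : ε ^ ((d : ℝ)⁻¹) ≤ 1 := Real.rpow_le_one hε.1.le hε.2.le (by positivity)
  set t := ε ^ ((d : ℝ)⁻¹)
  refine ⟨WithLp.ofLp ⁻¹' Icc (0 : Fin d → ℝ) fun _ => t, ?_, ?_, ?_⟩
  · intro x hx i
    exact ⟨hx.1 i, (hx.2 i).trans ht1⟩
  · exact (convex_Icc _ _).linear_preimage (WithLp.linearEquiv 2 ℝ (Fin d → ℝ)).toLinearMap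
  · rw [(PiLp.volume_preserving_ofLp (Fin d)).measure_preimage
      measurableSet_Icc.nullMeasurableSet, Real.volume_Icc_pi]
    simp [← ENNReal.ofReal_pow ht0, ht]

/-- For every `ε`-net `N` for convex sets in `[0,1]^d` there is a convex set of volume `ε`
containing at least `c_d · log log (1/ε)` points of `N`, for a constant `c_d > 0` depending
only on `d`. -/
theorem eps_net_lower_bound {d : ℕ} (hd : 2 ≤ d) :
    ∃ c : ℝ, 0 < c ∧ ∀ ε : ℝ, ε ∈ Set.Ioo (0 : ℝ) 1 →
      ∀ N : Set (EuclideanSpace ℝ (Fin d)), N ⊆ unitCube d →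
        (∀ K : Set (EuclideanSpace ℝ (Fin d)), K ⊆ unitCube d → Convex ℝ K →
          volume K = ENNReal.ofReal ε → (N ∩ K).Nonempty) →
        ∃ K : Set (EuclideanSpace ℝ (Fin d)), K ⊆ unitCube d ∧ Convex ℝ K ∧
          volume K = ENNReal.ofReal ε ∧
          ∃ S : Finset (EuclideanSpace ℝ (Fin d)), ↑S ⊆ N ∩ K ∧
            c * Real.log (Real.log (1 / ε)) ≤ S.card := by
  obtain ⟨C, hC, hlarge⟩ := exists_convex_of_log_large hd
  have hlogC : 0 ≤ Real.log C := Real.log_nonneg hC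
  refine ⟨(2 * (Real.log C + 1))⁻¹, by positivity, ?_⟩
  intro ε hε N _ hN
  rcases le_or_gt (Real.log (Real.log (1 / ε))) (2 * (Real.log C + 1)) with hsmall | hbig
  · obtain ⟨K, hK, hKc, hKε⟩ := exists_convex_volume_eq (by omega : d ≠ 0) hε
    obtain ⟨p, hp⟩ := hN K hK hKc hKε
    refine ⟨K, hK, hKc, hKε, {p}, by simpa using hp, ?_⟩
    rw [Finset.card_singleton, Nat.cast_one, inv_mul_le_iff₀ (by positivity), mul_one]
    exact hsmall
  · set l := Real.log (Real.log (1 / ε)) with hl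
    have hL : 0 < Real.log (1 / ε) := Real.log_pos ((one_lt_div hε.1).2 hε.2)
    have hk0 : 0 ≤ l - Real.log C := by linarith
    obtain ⟨K, hK, hKc, hKε, S, hS, hk⟩ := hlarge ε hε.1 N hN ⌊l - Real.log C⌋₊ <| by
      rw [← Real.log_le_log_iff (by positivity) hL, Real.log_mul (by positivity) (by positivity),
        Real.log_pow, ← hl]
      have h1 := Nat.floor_le hk0
      have h2 : Real.log 2 ≤ 1 := by linarith [Real.log_two_lt_d9]
      have h3 : (0 : ℝ) ≤ ⌊l - Real.log C⌋₊ := Nat.cast_nonneg _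
      nlinarith
    refine ⟨K, hK, hKc, hKε, S, hS, ?_⟩
    rw [hk, inv_mul_le_iff₀ (by positivity)]
    have h1 := Nat.lt_floor_add_one (l - Real.log C)
    nlinarith
end
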